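/- Let W = G(2,2,n) with n ≥ 4 (the Coxeter group of type D_n). Then the absolute order abs(W) does not contain the product of claw posets C_2 × C_4 × ⋯ × C_{2n−2} × C_n: there is no bijection φ from C_2 × C_4 × ⋯ × C_{2n−2} × C_n onto W such that the rank of x in the product poset equals ℓ_R(φ(x)) for every x and such that x ≤ y in the product poset implies φ(x) ≤ φ(y) in abs(W). -/

import Mathlib

open Module Set

noncomputable section

variable {V : Type*} [AddCommGroup V] [Module ℂ V]

/-- The codimension of the fixed subspace of a linear automorphism. -/
def fixCodim (w : V ≃ₗ[ℂ] V) : ℕ :=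
  finrank ℂ V - finrank ℂ (LinearMap.ker ((w : V →ₗ[ℂ] V) - 1))

/-- A reflection: fixed space has codimension one. -/
def IsReflection (w : V ≃ₗ[ℂ] V) : Prop := fixCodim w = 1

/-- A finite subgroup of GL(V) generated by its reflections. -/
def IsComplexReflectionGroup (W : Set (V ≃ₗ[ℂ] V)) : Prop :=
  W.Finite ∧ W = (Subgroup.closure {t | t ∈ W ∧ IsReflection t} : Subgroup (V ≃ₗ[ℂ] V))

/-- Reflection length with respect to the reflections of `W`. -/
def reflLen (W : Set (V ≃ₗ[ℂ] V)) (w : V ≃ₗ[ℂ] V) : ℕ :=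
  sInf {k | ∃ l : List (V ≃ₗ[ℂ] V), l.length = k ∧
    (∀ t ∈ l, t ∈ W ∧ IsReflection t) ∧ l.prod = w}

/-- The prefix order relation. -/
def preLe (W : Set (V ≃ₗ[ℂ] V)) (u v : V ≃ₗ[ℂ] V) : Prop :=
  reflLen W u + reflLen W (u⁻¹ * v) = reflLen W v

/-- The codimension order relation. -/
def coLe (u v : V ≃ₗ[ℂ] V) : Prop :=
  fixCodim u + fixCodim (u⁻¹ * v) = fixCodim v

/-- The group `G(m,p,n)` of monomial matrices with `m`-th root of unity entries whose
product is an `(m/p)`-th root of unity, as linear automorphisms of `ℂⁿ`. -/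
def Gmpn (m p n : ℕ) : Set ((Fin n → ℂ) ≃ₗ[ℂ] (Fin n → ℂ)) :=
  {w | ∃ (σ : Equiv.Perm (Fin n)) (a : Fin n → ℂ),
    (∀ i, a i ^ m = 1) ∧ (∏ i, a i) ^ (m / p) = 1 ∧
    ∀ j, w (Pi.single j (1 : ℂ)) = a j • (Pi.single (σ j) (1 : ℂ) : Fin n → ℂ)}

section Poset

variable {α : Type*}

/-- An antichain of the poset on carrier `P` with order relation `le`. -/
def IsAntichainOn (P : Set α) (le : α → α → Prop) (A : Set α) : Prop :=
  A ⊆ P ∧ ∀ x ∈ A, ∀ y ∈ A, x ≠ y → ¬ le x y ∧ ¬ le y x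

/-- `k`-Sperner: no union of `k` antichains is larger than the union of some `k` ranks
(equivalently, of the `k` largest ranks). -/
def IsKSpernerOn (P : Set α) (le : α → α → Prop) (rk : α → ℕ) (k : ℕ) : Prop :=
  ∀ 𝒜 : Fin k → Set α, (∀ i, IsAntichainOn P le (𝒜 i)) →
    ∃ S : Finset ℕ, S.card ≤ k ∧ (⋃ i, 𝒜 i).ncard ≤ {x | x ∈ P ∧ rk x ∈ S}.ncard

def IsStronglySpernerOn (P : Set α) (le : α → α → Prop) (rk : α → ℕ) : Prop :=
  ∀ k, IsKSpernerOn P le rk k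

/-- Sperner: no antichain is larger than some (equivalently, the largest) rank. -/
def IsSpernerOn (P : Set α) (le : α → α → Prop) (rk : α → ℕ) : Prop :=
  ∀ A : Set α, IsAntichainOn P le A → ∃ i, A.ncard ≤ {x | x ∈ P ∧ rk x = i}.ncard

/-- Covering relation of the poset on carrier `P`. -/
def CoversOn (P : Set α) (le : α → α → Prop) (x y : α) : Prop :=
  x ∈ P ∧ y ∈ P ∧ le x y ∧ x ≠ y ∧ ∀ z ∈ P, le x z → le z y → z = x ∨ z = y

/-- A normalized flow on the bipartite graph with parts `A`, `B`, edge relation `E`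
and vertex weights `ν`. -/
def IsNormalizedFlowBetween (A B : Set α) (E : α → α → Prop) (ν : α → ℝ)
    (f : α → α → ℝ) : Prop :=
  (∀ a b, 0 ≤ f a b) ∧
  (∀ a b, f a b ≠ 0 → a ∈ A ∧ b ∈ B ∧ E a b) ∧
  (∀ a ∈ A, (∑ᶠ b ∈ B, f a b) = ν a / ∑ᶠ x ∈ A, ν x) ∧
  (∀ b ∈ B, (∑ᶠ a ∈ A, f a b) = ν b / ∑ᶠ x ∈ B, ν x)

/-- A ranked poset has a normalized flow if each bipartite graph of covering relations
between consecutive ranks admits one. -/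
def HasNormalizedFlowOn (P : Set α) (le : α → α → Prop) (rk : α → ℕ) (ν : α → ℝ) : Prop :=
  ∀ i : ℕ, ∃ f, IsNormalizedFlowBetween {x | x ∈ P ∧ rk x = i} {x | x ∈ P ∧ rk x = i + 1}
    (CoversOn P le) ν f

end Poset


/-- Sizes of the factors of the product of claw posets `C_2 × C_4 × ⋯ × C_{2n-2} × C_n`. -/
def dClawSize (n : ℕ) (j : Fin n) : ℕ :=
  if (j : ℕ) + 1 < n then 2 * ((j : ℕ) + 1) else n

/-- The rank of an element of `C_2 × C_4 × ⋯ × C_{2n-2} × C_n`, where the claw poset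
`C_N` is modelled on `Fin N` with bottom element `0` and all other elements of rank 1. -/
def dClawRank {n : ℕ} (x : ∀ j : Fin n, Fin (dClawSize n j)) : ℕ :=
  {j | (x j : ℕ) ≠ 0}.ncard

/-- The componentwise order on `C_2 × C_4 × ⋯ × C_{2n-2} × C_n`. -/
def dClawLe {n : ℕ} (x y : ∀ j : Fin n, Fin (dClawSize n j)) : Prop :=
  ∀ j, x j = y j ∨ (x j : ℕ) = 0

/-- A root of type `D`: a vector `e_i - ε e_j` with `i ≠ j` and `ε = ±1`. -/
def IsRootD {n : ℕ} (α : Fin n → ℤ) : Prop :=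
  ∃ i j : Fin n, i ≠ j ∧ ∃ ε : ℤ, (ε = 1 ∨ ε = -1) ∧ α = Pi.single i 1 - Pi.single j ε

/-- An integer vector viewed in `ℂⁿ`. -/
def complexVec {n : ℕ} (α : Fin n → ℤ) : Fin n → ℂ := fun m => (α m : ℂ)

/-- `t` is the reflection `v ↦ v - ⟨α, v⟩ α`. -/
def ReflectsIn {n : ℕ} (t : (Fin n → ℂ) ≃ₗ[ℂ] (Fin n → ℂ)) (α : Fin n → ℤ) : Prop :=
  ∀ v, t v = v - (complexVec α ⬝ᵥ v) • complexVec α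

theorem complexVec_dotProduct {n : ℕ} (α β : Fin n → ℤ) :
    complexVec α ⬝ᵥ complexVec β = ((α ⬝ᵥ β : ℤ) : ℂ) := by
  simp [complexVec, dotProduct]

theorem IsRootD.dotProduct_self {n : ℕ} {α : Fin n → ℤ} (h : IsRootD α) : α ⬝ᵥ α = 2 := by
  obtain ⟨i, j, hij, ε, hε, rfl⟩ := h
  have hji := hij.symm
  rcases hε with rfl | rfl <;> simp [dotProduct_sub, hij, hji]

theorem IsRootD.complexVec_dotProduct_self {n : ℕ} {α : Fin n → ℤ} (h : IsRootD α) :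
    complexVec α ⬝ᵥ complexVec α = 2 := by
  rw [complexVec_dotProduct, h.dotProduct_self]; norm_num

theorem ReflectsIn.unique {n : ℕ} {s t : (Fin n → ℂ) ≃ₗ[ℂ] (Fin n → ℂ)} {α : Fin n → ℤ}
    (hs : ReflectsIn s α) (ht : ReflectsIn t α) : s = t := by
  ext1 v
  rw [hs v, ht v]

theorem ReflectsIn.neg {n : ℕ} {t : (Fin n → ℂ) ≃ₗ[ℂ] (Fin n → ℂ)} {α : Fin n → ℤ}
    (ht : ReflectsIn t α) : ReflectsIn t (-α) := by
  intro v
  have : complexVec (-α) = -complexVec α := by ext; simp [complexVec]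
  rw [ht v, this]
  simp

theorem ReflectsIn.involutive {n : ℕ} {t : (Fin n → ℂ) ≃ₗ[ℂ] (Fin n → ℂ)} {α : Fin n → ℤ}
    (hα : IsRootD α) (ht : ReflectsIn t α) (v : Fin n → ℂ) : t (t v) = v := by
  rw [ht (t v), ht v, dotProduct_sub, dotProduct_smul, hα.complexVec_dotProduct_self]
  simp only [smul_eq_mul]
  module

/-- The reflections of `G(2,2,n)` are the reflections in the roots of type `D`. -/
theorem exists_root_of_isReflection {n : ℕ} {t : (Fin n → ℂ) ≃ₗ[ℂ] (Fin n → ℂ)}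
    (ht : t ∈ Gmpn 2 2 n) (hr : IsReflection t) : ∃ α, IsRootD α ∧ ReflectsIn t α := by
  obtain ⟨σ, a, ha, hprod, hσ⟩ := ht
  simp only [Nat.div_self (Nat.succ_pos 1), pow_one] at hprod
  set f : (Fin n → ℂ) →ₗ[ℂ] (Fin n → ℂ) := (t : (Fin n → ℂ) →ₗ[ℂ] (Fin n → ℂ)) - 1 with hf
  have hrank : finrank ℂ (LinearMap.range f) = 1 := by
    have h1 := f.finrank_range_add_finrank_ker
    have h2 : finrank ℂ (Fin n → ℂ) - finrank ℂ (LinearMap.ker f) = 1 := hr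
    omega
  obtain ⟨⟨u, hu⟩, -, hspan⟩ := finrank_eq_one_iff'.1 hrank
  have hcol : ∀ v, ∃ c : ℂ, c • u = f v := fun v => by
    obtain ⟨c, hc⟩ := hspan ⟨f v, v, rfl⟩
    exact ⟨c, congrArg Subtype.val hc⟩
  have hentry : ∀ k m, f (Pi.single m 1) k =
      (if k = σ m then a m else 0) - (if k = m then 1 else 0) := by
    intro k m
    simp [hf, hσ, Pi.single_apply]
  have hminor : ∀ k l m m', f (Pi.single m 1) k * f (Pi.single m' 1) l =
      f (Pi.single m 1) l * f (Pi.single m' 1) k := by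
    intro k l m m'
    obtain ⟨c, hc⟩ := hcol (Pi.single m 1)
    obtain ⟨c', hc'⟩ := hcol (Pi.single m' 1)
    rw [← hc, ← hc']
    simp only [Pi.smul_apply, smul_eq_mul]
    ring
  have hne : ∃ i, σ i ≠ i := by
    by_contra! h
    have hdiag : ∀ m m', m ≠ m' → (a m - 1) * (a m' - 1) = 0 := by
      intro m m' hmm
      have := hminor m m' m m'
      simpa [hentry, h, hmm, hmm.symm] using this
    have hone : ∀ m, a m = 1 := by
      intro m
      by_contra hm
      rw [Finset.prod_eq_single m] at hprod
      · exact hm hprod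
      · intro m' _ hmm
        have := hdiag m m' hmm.symm
        rcases mul_eq_zero.1 this with h0 | h0
        · exact absurd (sub_eq_zero.1 h0) hm
        · exact sub_eq_zero.1 h0
      · simp
    have hzero : f = 0 := by
      refine LinearMap.pi_ext' fun m => LinearMap.ext_ring ?_
      ext k
      simp [hentry, h, hone]
    rw [hzero, LinearMap.range_zero, finrank_bot] at hrank
    exact zero_ne_one hrank
  obtain ⟨i, hi⟩ := hne
  have hfix : ∀ m, m ≠ i → m ≠ σ i → σ m = m ∧ a m = 1 := by
    intro m hmi hmj
    have := hminor i m i m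
    by_cases hm : σ m = m
    · refine ⟨hm, ?_⟩
      simp [hentry, hi.symm, hmi, hmj, hm] at this
      exact (sub_eq_zero.1 this).symm
    · simp [hentry, hi.symm, hmi, hmj, Ne.symm hm] at this
  have hj : σ (σ i) = i := by
    by_contra h
    have h1 : σ (σ i) ≠ σ i := fun h' => hi (σ.injective h')
    exact h1 (σ.injective (hfix _ h h1).1)
  have haa : a (σ i) = a i := by
    have := hminor i (σ i) i (σ i)
    simp [hentry, hi, hi.symm, hj] at this
    have h2 := ha i
    calc a (σ i) = a i ^ 2 * a (σ i) := by rw [h2, one_mul]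
      _ = a i * (a i * a (σ i)) := by ring
      _ = a i := by rw [← this, mul_one]
  obtain ⟨ε, hε, hεa⟩ : ∃ ε : ℤ, (ε = 1 ∨ ε = -1) ∧ a i = (ε : ℂ) := by
    rcases sq_eq_sq_iff_eq_or_eq_neg.1 ((ha i).trans (one_pow 2).symm) with h | h
    · exact ⟨1, Or.inl rfl, by simp [h]⟩
    · exact ⟨-1, Or.inr rfl, by simp [h]⟩
  refine ⟨Pi.single i 1 - Pi.single (σ i) ε, ⟨i, σ i, hi.symm, ε, hε, rfl⟩, ?_⟩
  set α : Fin n → ℤ := Pi.single i 1 - Pi.single (σ i) ε with hα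
  have hαm : ∀ m, m ≠ i → m ≠ σ i → α m = 0 := fun m h1 h2 => by simp [hα, h1, h2]
  have hαi : α i = 1 := by simp [hα, hi.symm]
  have hαj : α (σ i) = -ε := by simp [hα, hi]
  have hεε : (ε : ℂ) * ε = 1 := by rcases hε with rfl | rfl <;> simp
  have hlin : f = -(LinearMap.toSpanSingleton ℂ (Fin n → ℂ) (complexVec α) ∘ₗ
      dotProductBilin ℂ ℂ (complexVec α)) := by
    refine LinearMap.pi_ext' fun m => LinearMap.ext_ring ?_
    ext k
    have hgoal : f (Pi.single m 1) k = -((α m : ℂ) * α k) := by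
      rw [hentry]
      by_cases hmi : m = i
      · subst hmi
        by_cases hki : k = m
        · subst hki; simp [hαi, hi.symm]
        · by_cases hkj : k = σ m
          · subst hkj; simp [hαi, hαj, hi, hεa]
          · simp [hαm k hki hkj, hki, hkj]
      · by_cases hmj : m = σ i
        · subst hmj
          by_cases hki : k = i
          · subst hki; simp [hαi, hαj, hi.symm, hj, haa, hεa]
          · by_cases hkj : k = σ i
            · subst hkj; simp [hαj, hi, hj, hεε]
            · simp [hαm k hki hkj, hki, hkj, hj]
        · simp [hαm m hmi hmj, hfix m hmi hmj]
    simpa [complexVec] using hgoal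
  intro v
  have hv : t v - v = -((complexVec α ⬝ᵥ v) • complexVec α) := LinearMap.congr_fun hlin v
  rw [sub_eq_iff_eq_add.1 hv]
  abel

theorem mem_of_reflLen_eq_one {V : Type*} [AddCommGroup V] [Module ℂ V]
    {W : Set (V ≃ₗ[ℂ] V)} {t : V ≃ₗ[ℂ] V}
    (h : reflLen W t = 1) : t ∈ W ∧ IsReflection t := by
  have hmem := Nat.sInf_mem (Nat.nonempty_of_pos_sInf (h.symm ▸ one_pos : 0 < reflLen W t))
  obtain ⟨l, hl, hW, hprod⟩ := hmem
  obtain ⟨s, rfl⟩ := List.length_eq_one_iff.1 (hl.trans h)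
  simp only [List.prod_singleton] at hprod
  exact hprod ▸ hW s (by simp)

theorem mul_mem_Gmpn {n : ℕ} {s t : (Fin n → ℂ) ≃ₗ[ℂ] (Fin n → ℂ)}
    (hs : s ∈ Gmpn 2 2 n) (ht : t ∈ Gmpn 2 2 n) : s * t ∈ Gmpn 2 2 n := by
  obtain ⟨σ, a, ha, hpa, hσ⟩ := hs
  obtain ⟨τ, b, hb, hpb, hτ⟩ := ht
  refine ⟨σ * τ, fun j => b j * a (τ j), fun i => ?_, ?_, fun j => ?_⟩
  · rw [mul_pow, ha, hb, one_mul]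
  · rw [Finset.prod_mul_distrib, Equiv.prod_comp τ a, mul_pow, hpa, hpb, one_mul]
  · rw [LinearEquiv.mul_apply, hτ, map_smul, hσ, smul_smul, Equiv.Perm.mul_apply]

section Orthogonal

variable {n : ℕ} {s r t t' : (Fin n → ℂ) ≃ₗ[ℂ] (Fin n → ℂ)} {α β γ δ : Fin n → ℤ}

theorem mul_apply_of_orthogonal (ht : ReflectsIn t α) (ht' : ReflectsIn t' β)
    (hαβ : α ⬝ᵥ β = 0) (v : Fin n → ℂ) : (t * t') v =
      v - (complexVec α ⬝ᵥ v) • complexVec α - (complexVec β ⬝ᵥ v) • complexVec β := by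
  rw [LinearEquiv.mul_apply, ht' v, ht, dotProduct_sub, dotProduct_smul, complexVec_dotProduct,
    hαβ]
  simp only [Int.cast_zero, smul_zero, sub_zero]
  abel

theorem mul_apply_left_root (hα : IsRootD α) (ht : ReflectsIn t α) (ht' : ReflectsIn t' β)
    (hαβ : α ⬝ᵥ β = 0) : (t * t') (complexVec α) = -complexVec α := by
  rw [mul_apply_of_orthogonal ht ht' hαβ, hα.complexVec_dotProduct_self, complexVec_dotProduct,
    dotProduct_comm, hαβ]
  simp only [Int.cast_zero, zero_smul, sub_zero]
  module

theorem complexVec_ne_zero (hα : IsRootD α) : complexVec α ≠ 0 := by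
  intro h
  simpa [h] using hα.complexVec_dotProduct_self

theorem mul_ne_one_of_orthogonal (hα : IsRootD α) (ht : ReflectsIn t α)
    (ht' : ReflectsIn t' β) (hαβ : α ⬝ᵥ β = 0) : t * t' ≠ 1 := by
  intro h
  have h1 := mul_apply_left_root hα ht ht' hαβ
  rw [h, LinearEquiv.coe_one, id, eq_neg_iff_add_eq_zero, ← two_smul ℂ] at h1
  exact complexVec_ne_zero hα (by simpa using h1)

/-- The product of two orthogonal reflections has reflection length two. -/
theorem reflLen_mul_of_orthogonal (hα : IsRootD α) (hβ : IsRootD β) (ht : ReflectsIn t α)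
    (ht' : ReflectsIn t' β) (hαβ : α ⬝ᵥ β = 0) (hmem : t ∈ Gmpn 2 2 n ∧ IsReflection t)
    (hmem' : t' ∈ Gmpn 2 2 n ∧ IsReflection t') : reflLen (Gmpn 2 2 n) (t * t') = 2 := by
  have hset : 2 ∈ {k | ∃ l : List ((Fin n → ℂ) ≃ₗ[ℂ] (Fin n → ℂ)), l.length = k ∧
      (∀ t ∈ l, t ∈ Gmpn 2 2 n ∧ IsReflection t) ∧ l.prod = t * t'} :=
    ⟨[t, t'], rfl, by simp [hmem, hmem'], by simp⟩
  have hle : reflLen (Gmpn 2 2 n) (t * t') ≤ 2 := Nat.sInf_le hset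
  have h0 : reflLen (Gmpn 2 2 n) (t * t') ≠ 0 := by
    intro h
    obtain ⟨l, hl, -, hprod⟩ := Nat.sInf_mem ⟨2, hset⟩
    have hnil : l = [] := List.length_eq_zero_iff.1 (hl.trans h)
    rw [hnil, List.prod_nil] at hprod
    exact mul_ne_one_of_orthogonal hα ht ht' hαβ hprod.symm
  have h1 : reflLen (Gmpn 2 2 n) (t * t') ≠ 1 := by
    intro h
    obtain ⟨hW, hR⟩ := mem_of_reflLen_eq_one h
    obtain ⟨δ, hδ, htδ⟩ := exists_root_of_isReflection hW hR
    have hα2 := mul_apply_left_root hα ht ht' hαβ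
    have hβ2 : (t * t') (complexVec β) = -complexVec β := by
      rw [mul_apply_of_orthogonal ht ht' hαβ, hβ.complexVec_dotProduct_self,
        complexVec_dotProduct, hαβ]
      simp only [Int.cast_zero, zero_smul, sub_zero]
      module
    rw [htδ] at hα2 hβ2
    have e1 := congrArg (complexVec α ⬝ᵥ ·) hα2
    have e2 := congrArg (complexVec β ⬝ᵥ ·) hβ2
    have e3 := congrArg (complexVec β ⬝ᵥ ·) hα2
    simp only [dotProduct_sub, dotProduct_smul, dotProduct_neg, hα.complexVec_dotProduct_self,
      hβ.complexVec_dotProduct_self, complexVec_dotProduct, dotProduct_comm β α, hαβ,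
      dotProduct_comm α δ, dotProduct_comm β δ, smul_eq_mul] at e1 e2 e3
    have h3 : ((δ ⬝ᵥ α : ℤ) : ℂ) * ((δ ⬝ᵥ β : ℤ) : ℂ) = 0 := by
      rw [Int.cast_zero] at e3
      linear_combination -e3
    rcases mul_eq_zero.1 h3 with h0 | h0
    · rw [h0] at e1; norm_num at e1
    · rw [h0] at e2; norm_num at e2
  omega

/-- Roots of a reflection factorization vanish on the fixed space of the product. -/
theorem dotProduct_eq_zero_of_mul_fixed (hγ : IsRootD γ) (hδ : IsRootD δ) (hs : ReflectsIn s γ)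
    (hr : ReflectsIn r δ) (hne : s * r ≠ 1) {v : Fin n → ℂ} (hv : (s * r) v = v) :
    complexVec γ ⬝ᵥ v = 0 := by
  by_contra hγv
  have h1 : s v = r v := by
    rw [LinearEquiv.mul_apply] at hv
    conv_lhs => rw [← hv]
    exact hs.involutive hγ _
  rw [hs v, hr v, sub_right_inj] at h1
  set x := complexVec γ ⬝ᵥ v
  set y := complexVec δ ⬝ᵥ v
  have h2 : complexVec γ = (x⁻¹ * y) • complexVec δ := by
    rw [mul_smul, ← h1, smul_smul, inv_mul_cancel₀ hγv, one_smul]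
  have h3 : (x⁻¹ * y) * (x⁻¹ * y) = 1 := by
    have := hγ.complexVec_dotProduct_self
    rw [h2, smul_dotProduct, dotProduct_smul, hδ.complexVec_dotProduct_self] at this
    simp only [smul_eq_mul] at this
    linear_combination this / 2
  have hsr : s = r := by
    ext1 u
    rw [hs u, hr u, h2, smul_dotProduct, smul_smul, smul_eq_mul,
      mul_right_comm, h3, one_mul]
  apply hne
  ext1 u
  rw [LinearEquiv.mul_apply, ← hsr, hs.involutive hγ]
  rfl

/-- The only reflections below a product of two orthogonal reflections are its factors. -/
theorem eq_or_eq_of_mul_eq (hα : IsRootD α) (hβ : IsRootD β) (hγ : IsRootD γ) (hδ : IsRootD δ)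
    (ht : ReflectsIn t α) (ht' : ReflectsIn t' β) (hs : ReflectsIn s γ) (hr : ReflectsIn r δ)
    (hαβ : α ⬝ᵥ β = 0) (h : s * r = t * t') : s = t ∨ s = t' := by
  have key : ∀ {u : (Fin n → ℂ) ≃ₗ[ℂ] (Fin n → ℂ)} {ρ : Fin n → ℤ}, IsRootD ρ →
      ReflectsIn u ρ → (γ ⬝ᵥ ρ) ^ 2 = 4 → s = u := by
    intro u ρ hρ hu hsq
    have hself := hγ.dotProduct_self
    have hself' := hρ.dotProduct_self
    rcases sq_eq_sq_iff_eq_or_eq_neg.1 (hsq.trans (by norm_num : (4 : ℤ) = 2 ^ 2)) with h2 | h2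
    · have : γ - ρ = 0 := by
        rw [← dotProduct_self_eq_zero, sub_dotProduct, dotProduct_sub, dotProduct_sub,
          dotProduct_comm ρ γ]
        omega
      rw [sub_eq_zero.1 this] at hs
      exact hs.unique hu
    · have : γ + ρ = 0 := by
        rw [← dotProduct_self_eq_zero, add_dotProduct, dotProduct_add, dotProduct_add,
          dotProduct_comm ρ γ]
        omega
      rw [eq_neg_of_add_eq_zero_left this] at hs
      exact hs.unique hu.neg
  set p := γ ⬝ᵥ α with hp
  set q := γ ⬝ᵥ β with hq
  set v : Fin n → ℤ := (2 : ℤ) • γ - p • α - q • β with hv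
  have hαv : α ⬝ᵥ v = 0 := by
    rw [hv, dotProduct_sub, dotProduct_sub, dotProduct_smul, dotProduct_smul, dotProduct_smul,
      hαβ, hα.dotProduct_self, dotProduct_comm α γ, ← hp]
    simp only [smul_eq_mul]; ring
  have hβv : β ⬝ᵥ v = 0 := by
    rw [hv, dotProduct_sub, dotProduct_sub, dotProduct_smul, dotProduct_smul, dotProduct_smul,
      dotProduct_comm β α, hαβ, hβ.dotProduct_self, dotProduct_comm β γ, ← hq]
    simp only [smul_eq_mul]; ring
  have hfix : (s * r) (complexVec v) = complexVec v := by
    rw [h, mul_apply_of_orthogonal ht ht' hαβ, complexVec_dotProduct, complexVec_dotProduct,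
      hαv, hβv]
    simp
  have hγv := dotProduct_eq_zero_of_mul_fixed hγ hδ hs hr
    (h ▸ mul_ne_one_of_orthogonal hα ht ht' hαβ) hfix
  rw [complexVec_dotProduct, Int.cast_eq_zero, hv, dotProduct_sub, dotProduct_sub,
    dotProduct_smul, dotProduct_smul, dotProduct_smul, hγ.dotProduct_self, ← hp, ← hq] at hγv
  simp only [smul_eq_mul] at hγv
  have hsum : p ^ 2 + q ^ 2 = 4 := by linarith
  have hp2 : p ≤ 2 := by nlinarith
  have hp2' : -2 ≤ p := by nlinarith
  have hq2 : q ≤ 2 := by nlinarith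
  have hq2' : -2 ≤ q := by nlinarith
  have : p ^ 2 = 4 ∨ q ^ 2 = 4 := by
    interval_cases p <;> interval_cases q <;> omega
  exact this.imp (key hα ht) (key hβ ht')

end Orthogonal

/-- The support of an integer vector. -/
def intSupport {n : ℕ} (α : Fin n → ℤ) : Finset (Fin n) := Finset.univ.filter (α · ≠ 0)

theorem IsRootD.intSupport_eq {n : ℕ} {i j : Fin n} (hij : i ≠ j) {ε : ℤ} (hε : ε = 1 ∨ ε = -1) :
    intSupport (Pi.single i 1 - Pi.single j ε : Fin n → ℤ) = {i, j} := by
  ext k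
  have hε0 : ε ≠ 0 := by omega
  by_cases hki : k = i
  · subst hki; simp [intSupport, hij]
  · by_cases hkj : k = j
    · subst hkj; simp [intSupport, hki, hε0]
    · simp [intSupport, hki, hkj]

theorem IsRootD.card_intSupport {n : ℕ} {α : Fin n → ℤ} (h : IsRootD α) :
    (intSupport α).card = 2 := by
  obtain ⟨i, j, hij, ε, hε, rfl⟩ := h
  rw [IsRootD.intSupport_eq hij hε, Finset.card_pair hij]

theorem not_disjoint_intSupport {n : ℕ} {α β : Fin n → ℤ} (h : α ⬝ᵥ β ≠ 0) :
    ¬ Disjoint (intSupport α) (intSupport β) := by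
  intro hd
  apply h
  refine Finset.sum_eq_zero fun m _ => ?_
  by_contra hm
  rw [← ne_eq, mul_ne_zero_iff] at hm
  exact Finset.disjoint_left.1 hd (by simpa [intSupport] using hm.1)
    (by simpa [intSupport] using hm.2)

/-- Two non-orthogonal roots with the same support are equal up to sign. -/
theorem eq_or_eq_neg_of_intSupport_eq {n : ℕ} {α β : Fin n → ℤ} (hα : IsRootD α)
    (hβ : IsRootD β) (hsupp : intSupport α = intSupport β) (h : α ⬝ᵥ β ≠ 0) :
    α = β ∨ α = -β := by
  obtain ⟨i, j, hij, ε, hε, rfl⟩ := hα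
  obtain ⟨k, l, hkl, η, hη, rfl⟩ := hβ
  rw [IsRootD.intSupport_eq hij hε, IsRootD.intSupport_eq hkl hη] at hsupp
  have hji := hij.symm
  have hcases : i = k ∧ j = l ∨ i = l ∧ j = k := by
    have hi : i ∈ ({k, l} : Finset (Fin n)) := hsupp ▸ by simp
    have hj : j ∈ ({k, l} : Finset (Fin n)) := hsupp ▸ by simp
    simp only [Finset.mem_insert, Finset.mem_singleton] at hi hj
    grind
  rcases hcases with ⟨rfl, rfl⟩ | ⟨rfl, rfl⟩
  · rcases hε with rfl | rfl <;> rcases hη with rfl | rfl <;>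
      simp [dotProduct_sub, hij, hji] at h ⊢
  · rcases hε with rfl | rfl <;> rcases hη with rfl | rfl <;>
      simp [dotProduct_sub, hij, hji, Pi.single_neg] at h ⊢
    all_goals simp [add_comm]

section Atom

theorem dClawSize_pos {n : ℕ} (j : Fin n) : 0 < dClawSize n j := by
  have := j.2
  unfold dClawSize
  split_ifs <;> omega

/-- The element of the product of claws with single possibly nonzero coordinate `c` at `k`. -/
def dClawAtom {n : ℕ} (k : Fin n) (c : Fin (dClawSize n k)) : ∀ j : Fin n, Fin (dClawSize n j) :=
  Function.update (fun j => ⟨0, dClawSize_pos j⟩) k c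

theorem dClawAtom_injective {n : ℕ} (k : Fin n) : Function.Injective (dClawAtom k) := by
  intro c c' h
  simpa [dClawAtom] using congrFun h k

theorem dClawAtom_ne_zero_iff {n : ℕ} {k : Fin n} {c : Fin (dClawSize n k)} (hc : (c : ℕ) ≠ 0)
    (j : Fin n) : (dClawAtom k c j : ℕ) ≠ 0 ↔ j = k := by
  by_cases h : j = k
  · subst h; simpa [dClawAtom] using hc
  · simp [dClawAtom, h]

theorem dClawRank_atom {n : ℕ} {k : Fin n} {c : Fin (dClawSize n k)} (hc : (c : ℕ) ≠ 0) :
    dClawRank (dClawAtom k c) = 1 := by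
  simp only [dClawRank, dClawAtom_ne_zero_iff hc, Set.ofPred_eq_eq_singleton, Set.ncard_singleton]

theorem dClawLe_atom {n : ℕ} (y : ∀ j : Fin n, Fin (dClawSize n j)) (k : Fin n) :
    dClawLe (dClawAtom k (y k)) y := by
  intro j
  by_cases h : j = k
  · subst h; simp [dClawAtom]
  · simp [dClawAtom, h]

end Atom

/-- For `n ≥ 4` the absolute order on the type `Dₙ` Coxeter group `G(2,2,n)` does not
contain the product of claw posets `C_2 × C_4 × ⋯ × C_{2n-2} × C_n`. -/
theorem statement17 (n : ℕ) (hn : 4 ≤ n) :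
    ¬ ∃ φ : (∀ j : Fin n, Fin (dClawSize n j)) → ((Fin n → ℂ) ≃ₗ[ℂ] (Fin n → ℂ)),
      Set.BijOn φ Set.univ (Gmpn 2 2 n) ∧
      (∀ x, dClawRank x = reflLen (Gmpn 2 2 n) (φ x)) ∧
      (∀ x y, dClawLe x y → preLe (Gmpn 2 2 n) (φ x) (φ y)) := by
  rintro ⟨φ, hbij, hrank, hle⟩
  have hinj : Function.Injective φ := Set.injOn_univ.1 hbij.injOn
  have hatom : ∀ (k : Fin n) (c : Fin (dClawSize n k)), (c : ℕ) ≠ 0 →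
      φ (dClawAtom k c) ∈ Gmpn 2 2 n ∧ IsReflection (φ (dClawAtom k c)) := fun k c hc =>
    mem_of_reflLen_eq_one (by rw [← hrank, dClawRank_atom hc])
  have hroot : ∀ (k : Fin n) (c : Fin (dClawSize n k)), (c : ℕ) ≠ 0 →
      ∃ α, IsRootD α ∧ ReflectsIn (φ (dClawAtom k c)) α := fun k c hc =>
    exists_root_of_isReflection (hatom k c hc).1 (hatom k c hc).2
  -- Reflections coming from the same claw are not orthogonal.
  have horth : ∀ (k : Fin n) (c c' : Fin (dClawSize n k)), (c : ℕ) ≠ 0 → (c' : ℕ) ≠ 0 →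
      ∀ α β, IsRootD α → IsRootD β → ReflectsIn (φ (dClawAtom k c)) α →
        ReflectsIn (φ (dClawAtom k c')) β → α ⬝ᵥ β ≠ 0 := by
    intro k c c' hc hc' α β hα hβ ht ht' hαβ
    have hlen := reflLen_mul_of_orthogonal hα hβ ht ht' hαβ (hatom k c hc) (hatom k c' hc')
    obtain ⟨y, -, hy⟩ := hbij.surjOn (mul_mem_Gmpn (hatom k c hc).1 (hatom k c' hc').1)
    have hy2 : dClawRank y = 2 := by rw [hrank, hy, hlen]
    obtain ⟨p, q, hpq, hsupp⟩ := Set.ncard_eq_two.1 hy2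
    have hk : ∀ j, (y j : ℕ) ≠ 0 → j = k := by
      intro j hj
      obtain ⟨γ, hγ, hs⟩ := hroot j (y j) hj
      have hpre : preLe (Gmpn 2 2 n) (φ (dClawAtom j (y j))) (φ y) := hle _ _ (dClawLe_atom y j)
      rw [preLe, ← hrank, dClawRank_atom hj, hy, hlen] at hpre
      obtain ⟨hW, hR⟩ := mem_of_reflLen_eq_one (Nat.add_left_cancel hpre)
      obtain ⟨δ, hδ, hr⟩ := exists_root_of_isReflection hW hR
      have heq := eq_or_eq_of_mul_eq hα hβ hγ hδ ht ht' hs hr hαβ (mul_inv_cancel_left _ _)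
      have hjj := (dClawAtom_ne_zero_iff hj j).2 rfl
      rcases heq with h | h
      · rw [hinj h] at hjj
        exact (dClawAtom_ne_zero_iff hc j).1 hjj
      · rw [hinj h] at hjj
        exact (dClawAtom_ne_zero_iff hc' j).1 hjj
    have hp : p ∈ {j | (y j : ℕ) ≠ 0} := hsupp ▸ by simp
    have hq : q ∈ {j | (y j : ℕ) ≠ 0} := hsupp ▸ by simp
    exact hpq ((hk p hp).trans (hk q hq).symm)
  let k : Fin n := ⟨n - 2, by omega⟩
  have hsize : dClawSize n k = (2 * n - 3) + 1 := by
    simp only [dClawSize, k]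
    split_ifs <;> omega
  let c : Fin (2 * n - 3) → Fin (dClawSize n k) := fun m => Fin.cast hsize.symm m.succ
  have hc : ∀ m, (c m : ℕ) ≠ 0 := fun m => by simp [c]
  have hcinj : Function.Injective c := (Fin.cast_injective _).comp (Fin.succ_injective _)
  choose α hα ht using fun m => hroot k (c m) (hc m)
  have hne : ∀ m m', α m ⬝ᵥ α m' ≠ 0 := fun m m' =>
    horth k _ _ (hc m) (hc m') _ _ (hα m) (hα m') (ht m) (ht m')
  have hsinj : Function.Injective fun m => intSupport (α m) := by
    intro m m' h
    have heq : φ (dClawAtom k (c m)) = φ (dClawAtom k (c m')) := by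
      rcases eq_or_eq_neg_of_intSupport_eq (hα m) (hα m') h (hne m m') with h | h
      · exact (ht m).unique (h ▸ ht m')
      · exact (ht m).unique (h ▸ (ht m').neg)
    exact hcinj (dClawAtom_injective k (hinj heq))
  have hcard := Finset.erdos_ko_rado (𝒜 := Finset.univ.image fun m => intSupport (α m)) (r := 2)
    (by
      intro A hA B hB
      simp only [Finset.coe_image, Finset.coe_univ, Set.image_univ, Set.mem_range] at hA hB
      obtain ⟨m, rfl⟩ := hA
      obtain ⟨m', rfl⟩ := hB
      exact not_disjoint_intSupport (hne m m'))
    (by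
      intro A hA
      simp only [Finset.coe_image, Finset.coe_univ, Set.image_univ, Set.mem_range] at hA
      obtain ⟨m, rfl⟩ := hA
      exact (hα m).card_intSupport)
    (by omega)
  rw [Finset.card_image_of_injective _ hsinj, Finset.card_univ, Fintype.card_fin,
    Nat.choose_one_right] at hcard
  omega

end
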